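/- Let C₁, C₂ > 0, let d ≥ 1, and let N ≥ C₁ d be such that #(B_N ∩ ℤ^d) ≥ C₂^{−1} |B_N|. Let f : ℤ^d → ℝ be nonnegative, let F(x) = ∑_{y ∈ ℤ^d} f(y) χ_{y + Q_{1/2}}(x) be its step extension to ℝ^d, and set N₁ = (N² + d/4)^{1/2}. Then for every x ∈ ℤ^d, M_N^B f(x) ≤ 2 C₂ (N₁/N)^d 𝐌_{N₁}^B F(x) ≤ 2 C₂ e^{1/(8C₁²)} 𝐌_{N₁}^B F(x). (The pointwise domination (3.13) in the proof of Theorem 1.2.) -/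

import Mathlib

open MeasureTheory

/-- The set of lattice points in the closed Euclidean ball of radius `N`
centered at the origin of `ℝ^d`. -/
def latticeBallSet (d : ℕ) (N : ℝ) : Set (Fin d → ℤ) :=
  {y | ∑ j, ((y j : ℝ)) ^ 2 ≤ N ^ 2}

/-- The closed Euclidean ball of radius `N` centered at the origin of `ℝ^d`. -/
def euclideanBall (d : ℕ) (N : ℝ) : Set (Fin d → ℝ) :=
  {x | ∑ j, (x j) ^ 2 ≤ N ^ 2}

/-- The discrete Hardy–Littlewood averaging operator (real-valued):
`M_N^B f (x) = (1/#(B_N ∩ ℤ^d)) ∑_{y ∈ B_N ∩ ℤ^d} f (x - y)`. -/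
noncomputable def ballAvgR (d : ℕ) (N : ℝ) (f : (Fin d → ℤ) → ℝ) (x : Fin d → ℤ) : ℝ :=
  (∑ᶠ y ∈ latticeBallSet d N, f (x - y)) / ((latticeBallSet d N).ncard : ℝ)

/-- The step extension of `f : ℤ^d → ℝ` to `ℝ^d`:
`F(x) = ∑_{y ∈ ℤ^d} f(y) χ_{y + Q_{1/2}}(x)` with `Q_{1/2} = [-1/2, 1/2]^d`. -/
noncomputable def stepExt (d : ℕ) (f : (Fin d → ℤ) → ℝ) (x : Fin d → ℝ) : ℝ :=
  ∑' y : Fin d → ℤ,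
    f y * Set.indicator
      (Set.Icc (fun j => (y j : ℝ) - 1 / 2) (fun j => (y j : ℝ) + 1 / 2))
      (fun _ => (1 : ℝ)) x

/-- The continuous Hardy–Littlewood averaging operator over the Euclidean
ball: `𝐌_t^B F (x) = (1/|B_t|) ∫_{B_t} F (x + z) dz`. -/
noncomputable def contBallAvg (d : ℕ) (t : ℝ) (F : (Fin d → ℝ) → ℝ) (x : Fin d → ℝ) : ℝ :=
  (∫ z in euclideanBall d t, F (x + z)) / (volume (euclideanBall d t)).toReal

lemma isClosed_euclideanBall (d : ℕ) (t : ℝ) : IsClosed (euclideanBall d t) :=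
  isClosed_le (by fun_prop) continuous_const

lemma abs_apply_le_of_mem_euclideanBall {d : ℕ} {t : ℝ} (ht : 0 ≤ t) {z : Fin d → ℝ}
    (hz : z ∈ euclideanBall d t) (j : Fin d) : |z j| ≤ t := by
  have hz' : ∑ j, z j ^ 2 ≤ t ^ 2 := hz
  have h : z j ^ 2 ≤ ∑ j, z j ^ 2 :=
    Finset.single_le_sum (f := fun j => z j ^ 2) (fun i _ => sq_nonneg _) (Finset.mem_univ j)
  exact abs_le_of_sq_le_sq (h.trans hz') ht

lemma volume_euclideanBall_ne_top {d : ℕ} {t : ℝ} (ht : 0 ≤ t) :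
    volume (euclideanBall d t) ≠ ⊤ := by
  have hK : volume (Metric.closedBall (0 : Fin d → ℝ) t) ≠ ⊤ :=
    (isCompact_closedBall _ _).measure_lt_top.ne
  refine measure_ne_top_of_subset (fun z hz => ?_) hK
  rw [mem_closedBall_zero_iff, pi_norm_le_iff_of_nonneg ht]
  exact fun j => abs_apply_le_of_mem_euclideanBall ht hz j

lemma volume_euclideanBall_pos {d : ℕ} {t : ℝ} (ht : 0 < t) :
    0 < volume (euclideanBall d t) := by
  have ho : IsOpen {x : Fin d → ℝ | ∑ j, (x j) ^ 2 < t ^ 2} :=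
    isOpen_lt (by fun_prop) continuous_const
  have h₀ : ∑ _j : Fin d, (0 : ℝ) ^ 2 < t ^ 2 := by simpa using pow_pos ht 2
  refine (ho.measure_pos volume ⟨0, h₀⟩).trans_le (measure_mono fun x hx => ?_)
  have hx' : ∑ j, x j ^ 2 < t ^ 2 := hx
  exact hx'.le

lemma euclideanBall_mul {d : ℕ} {c : ℝ} (hc : 0 < c) (t : ℝ) :
    euclideanBall d (c * t) = (fun x => c • x) '' euclideanBall d t := by
  ext x
  simp only [Set.mem_image]
  constructor
  · intro hx
    refine ⟨c⁻¹ • x, ?_, by simp [smul_smul, hc.ne']⟩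
    have hx' : ∑ j, x j ^ 2 ≤ (c * t) ^ 2 := hx
    change ∑ j, (c⁻¹ * x j) ^ 2 ≤ t ^ 2
    simp_rw [mul_pow]
    rw [← Finset.mul_sum, inv_pow, inv_mul_le_iff₀ (by positivity), ← mul_pow]
    exact hx'
  · rintro ⟨y, hy, rfl⟩
    have hy' : ∑ j, y j ^ 2 ≤ t ^ 2 := hy
    change ∑ j, (c * y j) ^ 2 ≤ (c * t) ^ 2
    simp_rw [mul_pow]
    rw [← Finset.mul_sum]
    gcongr

lemma volume_euclideanBall_mul {d : ℕ} {c : ℝ} (hc : 0 < c) (t : ℝ) :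
    (volume (euclideanBall d (c * t))).toReal = c ^ d * (volume (euclideanBall d t)).toReal := by
  rw [euclideanBall_mul hc, Set.image_smul, Measure.addHaar_smul, ENNReal.toReal_mul,
    Module.finrank_fin_fun, abs_of_pos (pow_pos hc d), ENNReal.toReal_ofReal (by positivity)]

lemma mem_Icc_cube_iff {d : ℕ} (c z : Fin d → ℝ) :
    z ∈ Set.Icc (fun j => c j - 1 / 2) (fun j => c j + 1 / 2) ↔ ∀ j, |z j - c j| ≤ 1 / 2 := by
  simp only [Set.mem_Icc, Pi.le_def, ← forall_and, abs_le]
  refine forall_congr' fun j => ?_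
  constructor <;> rintro ⟨h₁, h₂⟩ <;> constructor <;> linarith

/-- By the symmetry of a cube about its center `y`, at least half of the unit cube centered at a
point of the ball of radius `N` lies in the ball of radius `√(N² + d/4)`. -/
lemma half_le_volume_euclideanBall_inter_cube {d : ℕ} {N : ℝ} {y : Fin d → ℝ}
    (hy : y ∈ euclideanBall d N) :
    1 / 2 ≤ volume.real (euclideanBall d (Real.sqrt (N ^ 2 + (d : ℝ) / 4)) ∩
      Set.Icc (fun j => y j - 1 / 2) (fun j => y j + 1 / 2)) := by
  set Q := Set.Icc (fun j => y j - 1 / 2) (fun j => y j + 1 / 2) with hQ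
  set A := {z | ∑ j, y j * (z j - y j) ≤ 0} ∩ Q with hA
  have hAm : MeasurableSet A := by
    refine (IsClosed.inter (isClosed_le (by fun_prop) continuous_const) isClosed_Icc).measurableSet
  have hy' : ∑ j, y j ^ 2 ≤ N ^ 2 := hy
  have hsub : A ⊆ euclideanBall d (Real.sqrt (N ^ 2 + (d : ℝ) / 4)) ∩ Q := by
    rintro z ⟨hz, hzQ⟩
    refine ⟨?_, hzQ⟩
    change ∑ j, z j ^ 2 ≤ _
    rw [Real.sq_sqrt (by positivity)]
    have hz' : ∑ j, y j * (z j - y j) ≤ 0 := hz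
    have h2 : ∑ j, (z j - y j) ^ 2 ≤ (d : ℝ) / 4 := by
      calc ∑ j, (z j - y j) ^ 2 ≤ ∑ _j : Fin d, (1 / 4 : ℝ) := by
            refine Finset.sum_le_sum fun j _ => ?_
            have := (mem_Icc_cube_iff y z).1 hzQ j
            nlinarith [sq_abs (z j - y j), abs_nonneg (z j - y j)]
        _ = (d : ℝ) / 4 := by simp; ring
    have h3 : ∑ j, z j ^ 2
        = ∑ j, y j ^ 2 + 2 * ∑ j, y j * (z j - y j) + ∑ j, (z j - y j) ^ 2 := by
      rw [Finset.mul_sum, ← Finset.sum_add_distrib, ← Finset.sum_add_distrib]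
      exact Finset.sum_congr rfl fun j _ => by ring
    linarith
  have hvQ : volume Q = 1 := by
    rw [hQ, Real.volume_Icc_pi]
    refine Finset.prod_eq_one fun j _ => ?_
    rw [show y j + 1 / 2 - (y j - 1 / 2) = 1 by ring, ENNReal.ofReal_one]
  have hcover : Q ⊆ A ∪ (fun z => ((2 : ℝ) • y) - z) ⁻¹' A := by
    intro z hz
    by_cases h : ∑ j, y j * (z j - y j) ≤ 0
    · exact Or.inl ⟨h, hz⟩
    · right
      refine ⟨?_, (mem_Icc_cube_iff _ _).2 fun j => ?_⟩
      · change ∑ j, y j * ((2 * y j - z j) - y j) ≤ 0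
        have : ∑ j, y j * ((2 * y j - z j) - y j) = -∑ j, y j * (z j - y j) := by
          rw [← Finset.sum_neg_distrib]
          exact Finset.sum_congr rfl fun j _ => by ring
        linarith
      · change |2 * y j - z j - y j| ≤ 1 / 2
        rw [show 2 * y j - z j - y j = -(z j - y j) by ring, abs_neg]
        exact (mem_Icc_cube_iff _ _).1 hz j
  have hpre : volume ((fun z => ((2 : ℝ) • y) - z) ⁻¹' A) = volume A :=
    (Measure.measurePreserving_sub_left volume ((2 : ℝ) • y)).measure_preimage hAm.nullMeasurableSet
  have hAtop : volume A ≠ ⊤ :=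
    measure_ne_top_of_subset Set.inter_subset_right (by simp [hvQ])
  have h1 : (1 : ENNReal) ≤ volume A + volume A := by
    rw [← hvQ]
    exact (measure_mono hcover).trans ((measure_union_le _ _).trans_eq (by rw [hpre]))
  have h2 : (1 : ℝ) ≤ volume.real A + volume.real A := by
    have := ENNReal.toReal_mono (ENNReal.add_ne_top.2 ⟨hAtop, hAtop⟩) h1
    rwa [ENNReal.toReal_one, ENNReal.toReal_add hAtop hAtop] at this
  have h3 := measureReal_mono (μ := volume) hsub
    (measure_ne_top_of_subset Set.inter_subset_right (by simp [hvQ]))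
  linarith

lemma stepExt_nonneg {d : ℕ} {f : (Fin d → ℤ) → ℝ} (hf : ∀ y, 0 ≤ f y) (x : Fin d → ℝ) :
    0 ≤ stepExt d f x :=
  tsum_nonneg fun y => mul_nonneg (hf y) (Set.indicator_nonneg (fun _ _ => zero_le_one) x)

lemma contBallAvg_nonneg {d : ℕ} {F : (Fin d → ℝ) → ℝ} (hF : ∀ x, 0 ≤ F x) (t : ℝ)
    (x : Fin d → ℝ) : 0 ≤ contBallAvg d t F x :=
  div_nonneg (integral_nonneg fun _ => hF _) ENNReal.toReal_nonneg

/-- The integral of the step extension over a ball centered at a lattice point is a finite sum,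
over a finite set that may be chosen to contain any prescribed one. -/
lemma exists_setIntegral_stepExt_eq_sum {d : ℕ} {t : ℝ} (ht : 0 ≤ t) (f : (Fin d → ℤ) → ℝ)
    (x : Fin d → ℤ) (T : Finset (Fin d → ℤ)) :
    ∃ S : Finset (Fin d → ℤ), T ⊆ S ∧
      ∫ z in euclideanBall d t, stepExt d f ((fun j => (x j : ℝ)) + z) =
        ∑ w ∈ S, f w * volume.real (euclideanBall d t ∩
          Set.Icc (fun j => ((w - x) j : ℝ) - 1 / 2) (fun j => ((w - x) j : ℝ) + 1 / 2)) := by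
  classical
  let K : Fin d → ℤ := fun _ => ⌈t + 1 / 2⌉
  refine ⟨T ∪ Finset.Icc (x - K) (x + K), Finset.subset_union_left, ?_⟩
  let Q : (Fin d → ℤ) → Set (Fin d → ℝ) := fun w =>
    Set.Icc (fun j => ((w - x) j : ℝ) - 1 / 2) (fun j => ((w - x) j : ℝ) + 1 / 2)
  have hQm : ∀ w, MeasurableSet (Q w) := fun w => measurableSet_Icc
  have hind : ∀ (w : Fin d → ℤ) (z : Fin d → ℝ),
      Set.indicator (Set.Icc (fun j => (w j : ℝ) - 1 / 2) (fun j => (w j : ℝ) + 1 / 2))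
        (fun _ => (1 : ℝ)) ((fun j => (x j : ℝ)) + z) =
      Set.indicator (Q w) (fun _ => (1 : ℝ)) z := by
    intro w z
    refine Set.indicator_eq_indicator ?_ rfl
    rw [mem_Icc_cube_iff (fun j => (w j : ℝ)), mem_Icc_cube_iff (fun j => ((w - x) j : ℝ))]
    refine forall_congr' fun j => ?_
    simp only [Pi.add_apply, Pi.sub_apply, Int.cast_sub]
    rw [show (x j : ℝ) + z j - w j = z j - (w j - x j) by ring]
  have hB : MeasurableSet (euclideanBall d t) := (isClosed_euclideanBall d t).measurableSet
  have hpt : ∀ z ∈ euclideanBall d t, stepExt d f ((fun j => (x j : ℝ)) + z) =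
      ∑ w ∈ T ∪ Finset.Icc (x - K) (x + K), f w * Set.indicator (Q w) (fun _ => (1 : ℝ)) z := by
    intro z hz
    rw [stepExt]
    simp_rw [hind]
    refine tsum_eq_sum fun w hw => ?_
    rw [Set.indicator_of_notMem, mul_zero]
    intro hzQ
    refine hw (Finset.mem_union_right _ (Finset.mem_Icc.2 ?_))
    have key : ∀ j, |w j - x j| ≤ K j := by
      intro j
      have h1 := (mem_Icc_cube_iff (fun j => ((w - x) j : ℝ)) z).1 hzQ j
      have h2 := abs_apply_le_of_mem_euclideanBall ht hz j
      have h3 := Int.le_ceil (t + 1 / 2)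
      simp only [Pi.sub_apply, Int.cast_sub] at h1
      have h4 : |(w j : ℝ) - x j| ≤ (⌈t + 1 / 2⌉ : ℤ) := by
        rw [abs_le] at *
        constructor <;> linarith [h1.1, h1.2, h2.1, h2.2]
      exact_mod_cast h4
    constructor <;> intro j <;> have := abs_le.1 (key j) <;>
      simp only [Pi.sub_apply, Pi.add_apply] <;> linarith [this.1, this.2]
  rw [setIntegral_congr_fun hB hpt, integral_finsetSum]
  · refine Finset.sum_congr rfl fun w _ => ?_
    rw [integral_const_mul, integral_indicator_const _ (hQm w), smul_eq_mul, mul_one,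
      measureReal_restrict_apply (hQm w), Set.inter_comm]
  · intro w _
    have : IsFiniteMeasure (volume.restrict (euclideanBall d t)) :=
      ⟨by simpa using (volume_euclideanBall_ne_top ht).lt_top⟩
    exact ((integrable_const (1 : ℝ)).indicator (hQm w)).const_mul _

lemma finsum_latticeBallSet_le {d : ℕ} {N : ℝ} (hfin : (latticeBallSet d N).Finite)
    {f : (Fin d → ℤ) → ℝ} (hf : ∀ y, 0 ≤ f y) (x : Fin d → ℤ) :
    ∑ᶠ y ∈ latticeBallSet d N, f (x - y) ≤
      2 * ∫ z in euclideanBall d (Real.sqrt (N ^ 2 + (d : ℝ) / 4)),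
        stepExt d f ((fun j => (x j : ℝ)) + z) := by
  classical
  obtain ⟨S, hTS, hS⟩ := exists_setIntegral_stepExt_eq_sum
    (Real.sqrt_nonneg (N ^ 2 + (d : ℝ) / 4)) f x (hfin.toFinset.image (x - ·))
  rw [hS, finsum_mem_eq_finite_toFinset_sum _ hfin,
    ← Finset.sum_image (f := f) (g := (x - ·)) (fun a _ b _ h => sub_right_injective h),
    Finset.mul_sum]
  refine (Finset.sum_le_sum fun w hw => ?_).trans
    (Finset.sum_le_sum_of_subset_of_nonneg hTS fun w _ _ =>
      mul_nonneg zero_le_two (mul_nonneg (hf w) measureReal_nonneg))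
  obtain ⟨y, hy, rfl⟩ := Finset.mem_image.1 hw
  have hy' : ∑ j, (y j : ℝ) ^ 2 ≤ N ^ 2 := hfin.mem_toFinset.1 hy
  have hmem : (fun j => ((x - y - x) j : ℝ)) ∈ euclideanBall d N := by
    change ∑ j, ((x - y - x) j : ℝ) ^ 2 ≤ N ^ 2
    simpa using hy'
  have := half_le_volume_euclideanBall_inter_cube hmem
  nlinarith [hf (x - y)]

lemma sqrt_div_pow_le_exp {C N : ℝ} {d : ℕ} (hC : 0 < C) (hN₀ : 0 < N) (hN : C * d ≤ N) :
    (Real.sqrt (N ^ 2 + (d : ℝ) / 4) / N) ^ d ≤ Real.exp (1 / (8 * C ^ 2)) := by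
  have h1 : Real.sqrt (N ^ 2 + (d : ℝ) / 4) / N ≤ Real.exp (d / (8 * N ^ 2)) := by
    rw [div_le_iff₀ hN₀]
    refine Real.sqrt_le_iff.2 ⟨by positivity, ?_⟩
    rw [mul_pow, ← Real.exp_nat_mul]
    have := Real.add_one_le_exp (((2 : ℕ) : ℝ) * (d / (8 * N ^ 2)))
    calc N ^ 2 + (d : ℝ) / 4 = (((2 : ℕ) : ℝ) * (d / (8 * N ^ 2)) + 1) * N ^ 2 := by
          push_cast; field_simp; ring
      _ ≤ _ := by gcongr
  calc _ ≤ Real.exp (d / (8 * N ^ 2)) ^ d := by gcongr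
    _ = Real.exp (d * (d / (8 * N ^ 2))) := (Real.exp_nat_mul _ _).symm
    _ ≤ _ := by
      refine Real.exp_le_exp.2 ?_
      rw [← mul_div_assoc, div_le_div_iff₀ (by positivity) (by positivity)]
      have : (C * d) ^ 2 ≤ N ^ 2 := by gcongr
      nlinarith

/-- The pointwise domination (3.13): for `N ≥ C₁ d` with
`#(B_N ∩ ℤ^d) ≥ C₂⁻¹ |B_N|`, nonnegative `f` and `N₁ = (N² + d/4)^{1/2}`,
`M_N^B f(x) ≤ 2C₂ (N₁/N)^d 𝐌_{N₁}^B F(x) ≤ 2C₂ e^{1/(8C₁²)} 𝐌_{N₁}^B F(x)`. -/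
theorem discrete_avg_dominated_by_continuous_avg
    (C₁ C₂ : ℝ) (hC₁ : 0 < C₁) (hC₂ : 0 < C₂)
    (d : ℕ) (hd : 1 ≤ d) (N : ℝ) (hN : C₁ * (d : ℝ) ≤ N)
    (hcard : C₂⁻¹ * (volume (euclideanBall d N)).toReal ≤ ((latticeBallSet d N).ncard : ℝ))
    (f : (Fin d → ℤ) → ℝ) (hf : ∀ y, 0 ≤ f y) (x : Fin d → ℤ) :
    ballAvgR d N f x ≤
        2 * C₂ * (Real.sqrt (N ^ 2 + (d : ℝ) / 4) / N) ^ d *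
          contBallAvg d (Real.sqrt (N ^ 2 + (d : ℝ) / 4)) (stepExt d f)
            (fun j => (x j : ℝ)) ∧
      2 * C₂ * (Real.sqrt (N ^ 2 + (d : ℝ) / 4) / N) ^ d *
          contBallAvg d (Real.sqrt (N ^ 2 + (d : ℝ) / 4)) (stepExt d f)
            (fun j => (x j : ℝ)) ≤
        2 * C₂ * Real.exp (1 / (8 * C₁ ^ 2)) *
          contBallAvg d (Real.sqrt (N ^ 2 + (d : ℝ) / 4)) (stepExt d f)
            (fun j => (x j : ℝ)) := by
  have hd' : (0 : ℝ) < d := by exact_mod_cast hd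
  have hN₀ : 0 < N := (mul_pos hC₁ hd').trans_le hN
  have hA₀ := contBallAvg_nonneg (stepExt_nonneg hf) (Real.sqrt (N ^ 2 + (d : ℝ) / 4))
    (fun j => (x j : ℝ))
  have hexp := sqrt_div_pow_le_exp hC₁ hN₀ hN
  refine ⟨?_, by gcongr⟩
  have hfinsum := fun h => finsum_latticeBallSet_le (N := N) h hf x
  set N₁ := Real.sqrt (N ^ 2 + (d : ℝ) / 4) with hN₁
  have hN₁₀ : 0 < N₁ := Real.sqrt_pos.2 (by positivity)
  have hvol : 0 < (volume (euclideanBall d N)).toReal :=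
    ENNReal.toReal_pos (volume_euclideanBall_pos hN₀).ne' (volume_euclideanBall_ne_top hN₀.le)
  have hcard₀ : (0 : ℝ) < (latticeBallSet d N).ncard :=
    (mul_pos (inv_pos.2 hC₂) hvol).trans_le hcard
  have hfin : (latticeBallSet d N).Finite := Set.finite_of_ncard_pos (by exact_mod_cast hcard₀)
  have hscale : (volume (euclideanBall d N₁)).toReal =
      (N₁ / N) ^ d * (volume (euclideanBall d N)).toReal := by
    rw [← volume_euclideanBall_mul (div_pos hN₁₀ hN₀), div_mul_cancel₀ _ hN₀.ne']
  have hI₀ : 0 ≤ ∫ z in euclideanBall d N₁, stepExt d f ((fun j => (x j : ℝ)) + z) :=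
    integral_nonneg fun _ => stepExt_nonneg hf _
  rw [ballAvgR, contBallAvg, hscale]
  set I := ∫ z in euclideanBall d N₁, stepExt d f ((fun j => (x j : ℝ)) + z)
  have hr : 0 < (N₁ / N) ^ d := by positivity
  calc _ ≤ 2 * I / ((latticeBallSet d N).ncard : ℝ) := by gcongr; exact hfinsum hfin
    _ ≤ 2 * I / (C₂⁻¹ * (volume (euclideanBall d N)).toReal) := by gcongr
    _ = _ := by field_simp
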